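/- (Generalised von Neumann theorem) Let n ≥ 1 and let T₁, T₂: F₂ⁿ → F₂ⁿ be invertible linear transformations such that T₁ − T₂ is also invertible. Then for any functions f, g, h: F₂ⁿ → [−1,1], one has |E_{x,r ∈ F₂ⁿ} f(x)·g(x + T₁r)·h(x + T₂r)| ≤ ‖f‖_{U²(F₂ⁿ)}. -/

import Mathlib

/-- The `2^d`-th power of the Gowers uniformity norm `‖f‖_{U^d(F₂ⁿ)}`:
the average of `∏_{ω ∈ {0,1}^d} f(x + ω₁h₁ + ⋯ + ω_dh_d)` over `x, h₁, …, h_d ∈ F₂ⁿ`. -/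
noncomputable def gowersPow (n d : ℕ) (f : (Fin n → ZMod 2) → ℝ) : ℝ :=
  (∑ x : Fin n → ZMod 2, ∑ h : Fin d → (Fin n → ZMod 2),
      ∏ ω : Fin d → ZMod 2, f (x + ∑ i, ω i • h i)) /
    ((Fintype.card (Fin n → ZMod 2) : ℝ) *
      (Fintype.card (Fin d → (Fin n → ZMod 2)) : ℝ))

/-- The Gowers uniformity norm `‖f‖_{U^d(F₂ⁿ)}`, the nonnegative `2^d`-th root of
the Gowers average `gowersPow n d f`. -/
noncomputable def gowersNorm (n d : ℕ) (f : (Fin n → ZMod 2) → ℝ) : ℝ :=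
  Real.rpow (gowersPow n d f) ((2 : ℝ) ^ d)⁻¹

theorem gvn_cs {V : Type*} [Fintype V] (K : V → V → ℝ) (G H : V → ℝ)
    (hG : ∀ x, G x ^ 2 ≤ 1) (hH : ∀ x, H x ^ 2 ≤ 1) :
    (∑ u, ∑ v, K u v * G u * H v) ^ 4 ≤
      (Fintype.card V : ℝ) ^ 4 * ∑ v, ∑ w, (∑ u, K u v * K u w) ^ 2 := by
  have bG : ∑ u, G u ^ 2 ≤ (Fintype.card V : ℝ) := by
    calc ∑ u, G u ^ 2 ≤ ∑ _u : V, (1 : ℝ) := Finset.sum_le_sum fun u _ => hG u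
      _ = _ := by simp
  have bH : ∑ u, H u ^ 2 ≤ (Fintype.card V : ℝ) := by
    calc ∑ u, H u ^ 2 ≤ ∑ _u : V, (1 : ℝ) := Finset.sum_le_sum fun u _ => hH u
      _ = _ := by simp
  have e1 : ∑ u, ∑ v, K u v * G u * H v = ∑ u, G u * ∑ v, K u v * H v := by
    refine Finset.sum_congr rfl fun u _ => ?_
    rw [Finset.mul_sum]
    exact Finset.sum_congr rfl fun v _ => by ring
  have c1 : (∑ u, ∑ v, K u v * G u * H v) ^ 2 ≤
      (Fintype.card V : ℝ) * ∑ u, (∑ v, K u v * H v) ^ 2 := by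
    rw [e1]
    exact (Finset.sum_mul_sq_le_sq_mul_sq _ _ _).trans
      (mul_le_mul_of_nonneg_right bG (by positivity))
  have e2 : ∑ u, (∑ v, K u v * H v) ^ 2 =
      ∑ p : V × V, (H p.1 * H p.2) * ∑ u, K u p.1 * K u p.2 := by
    simp only [Finset.mul_sum]
    rw [Finset.sum_comm]
    refine Finset.sum_congr rfl fun u _ => ?_
    rw [sq, Finset.sum_mul_sum, Fintype.sum_prod_type]
    exact Finset.sum_congr rfl fun v _ => Finset.sum_congr rfl fun w _ => by ring
  have bHH : ∑ p : V × V, (H p.1 * H p.2) ^ 2 ≤ (Fintype.card V : ℝ) ^ 2 := by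
    rw [Fintype.sum_prod_type]
    simp only [mul_pow]
    rw [← Finset.sum_mul_sum, ← sq]
    exact pow_le_pow_left₀ (Finset.sum_nonneg fun _ _ => sq_nonneg _) bH 2
  have c2 : (∑ u, (∑ v, K u v * H v) ^ 2) ^ 2 ≤
      (Fintype.card V : ℝ) ^ 2 * ∑ v, ∑ w, (∑ u, K u v * K u w) ^ 2 := by
    rw [e2, ← Fintype.sum_prod_type (fun p : V × V => (∑ u, K u p.1 * K u p.2) ^ 2)]
    exact (Finset.sum_mul_sq_le_sq_mul_sq _ _ _).trans
      (mul_le_mul_of_nonneg_right bHH (by positivity))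
  calc (∑ u, ∑ v, K u v * G u * H v) ^ 4
      = ((∑ u, ∑ v, K u v * G u * H v) ^ 2) ^ 2 := by ring
    _ ≤ ((Fintype.card V : ℝ) * ∑ u, (∑ v, K u v * H v) ^ 2) ^ 2 :=
        pow_le_pow_left₀ (sq_nonneg _) c1 2
    _ = (Fintype.card V : ℝ) ^ 2 * (∑ u, (∑ v, K u v * H v) ^ 2) ^ 2 := by ring
    _ ≤ (Fintype.card V : ℝ) ^ 2 * ((Fintype.card V : ℝ) ^ 2 *
          ∑ v, ∑ w, (∑ u, K u v * K u w) ^ 2) :=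
        mul_le_mul_of_nonneg_left c2 (by positivity)
    _ = _ := by ring

theorem gvn_shift {V : Type*} [Fintype V] [AddCommGroup V] (a : V) (F : V → ℝ) :
    ∑ x, F x = ∑ x, F (a + x) :=
  (Equiv.sum_comp (Equiv.addLeft a) F).symm

theorem gvn_box {V : Type*} [Fintype V] [AddCommGroup V] (f : V → ℝ) :
    ∑ v, ∑ w, (∑ u, f (u + v) * f (u + w)) ^ 2 =
      (Fintype.card V : ℝ) *
        ∑ x, ∑ a, ∑ b, f x * f (x + a) * f (x + b) * f (x + a + b) := by
  have key : ∀ v : V, ∑ w, (∑ u, f (u + v) * f (u + w)) ^ 2 =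
      ∑ x, ∑ a, ∑ b, f x * f (x + a) * f (x + b) * f (x + a + b) := by
    intro v
    simp only [sq, Finset.sum_mul_sum]
    rw [Finset.sum_comm, gvn_shift (-v)]
    refine Finset.sum_congr rfl fun x _ => ?_
    rw [Finset.sum_comm, gvn_shift (-v + x)]
    refine Finset.sum_congr rfl fun a _ => ?_
    rw [gvn_shift v]
    refine Finset.sum_congr rfl fun b _ => ?_
    rw [show -v + x + v = x by abel, show -v + x + (v + b) = x + b by abel,
      show -v + x + a + v = x + a by abel, show -v + x + a + (v + b) = x + a + b by abel]
    ring
  simp [key]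

theorem gvn_pow (n : ℕ) (f : (Fin n → ZMod 2) → ℝ) :
    gowersPow n 2 f = (∑ x, ∑ a, ∑ b, f x * f (x + a) * f (x + b) * f (x + a + b)) /
      (Fintype.card (Fin n → ZMod 2) : ℝ) ^ 3 := by
  unfold gowersPow
  congr 1
  · refine Finset.sum_congr rfl fun x _ => ?_
    rw [← Equiv.sum_comp (finTwoArrowEquiv (Fin n → ZMod 2)).symm, Fintype.sum_prod_type]
    refine Finset.sum_congr rfl fun a _ => Finset.sum_congr rfl fun b _ => ?_
    rw [← Equiv.prod_comp (finTwoArrowEquiv (ZMod 2)).symm, Fintype.prod_prod_type]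
    have P : ∀ F : ZMod 2 → ℝ, ∏ i, F i = F 0 * F 1 := fun F => Fin.prod_univ_two F
    simp only [P, Fin.sum_univ_two, finTwoArrowEquiv_symm_apply, Matrix.cons_val_zero,
      Matrix.cons_val_one, zero_smul, one_smul, add_zero, zero_add]
    rw [← add_assoc]
    ring
  · rw [Fintype.card_pi_const (Fin n → ZMod 2) 2]
    push_cast
    ring

/-- generalised von Neumann theorem for the `U²` norm. -/
theorem generalised_von_neumann (n : ℕ) (hn : 1 ≤ n)
    (T₁ T₂ : (Fin n → ZMod 2) →ₗ[ZMod 2] (Fin n → ZMod 2))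
    (hT₁ : Function.Bijective T₁) (hT₂ : Function.Bijective T₂)
    (hT₁₂ : Function.Bijective (T₁ - T₂))
    (f g h : (Fin n → ZMod 2) → ℝ)
    (hf : ∀ x, f x ∈ Set.Icc (-1 : ℝ) 1)
    (hg : ∀ x, g x ∈ Set.Icc (-1 : ℝ) 1)
    (hh : ∀ x, h x ∈ Set.Icc (-1 : ℝ) 1) :
    |(∑ x : Fin n → ZMod 2, ∑ r : Fin n → ZMod 2,
        f x * g (x + T₁ r) * h (x + T₂ r)) /
      ((Fintype.card (Fin n → ZMod 2) : ℝ) * (Fintype.card (Fin n → ZMod 2) : ℝ))| ≤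
      gowersNorm n 2 f := by
  classical
  have two : ∀ x : Fin n → ZMod 2, x + x = 0 := fun x => by
    ext i; exact CharTwo.add_self_eq_zero (x i)
  let e₁ := LinearEquiv.ofBijective T₁ hT₁
  let e₂ := LinearEquiv.ofBijective T₂ hT₂
  have h1 : ∀ x, T₁ (e₁.symm x) = x := fun x => e₁.apply_symm_apply x
  have h2 : ∀ x, T₂ (e₂.symm x) = x := fun x => e₂.apply_symm_apply x
  have inj : ∀ x, Function.Injective fun u => e₂.symm u + e₁.symm (x + u) := by
    intro x u v huv
    have h3 : e₂.symm (u - v) + e₁.symm (u - v) = 0 := by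
      simp only [map_add, map_sub] at huv ⊢
      linear_combination (exp := 1) huv
    set r := e₂.symm (u - v) with hr
    have h4 : T₁ r + (u - v) = 0 := by
      have := congrArg T₁ h3
      rwa [map_add, h1, map_zero] at this
    have h5 : T₂ r = u - v := h2 _
    have h6 : (T₁ - T₂) r = 0 := by
      rw [LinearMap.sub_apply, h5]
      have := two (u - v)
      linear_combination (exp := 1) h4 - this
    have h7 : r = 0 := hT₁₂.1 (by rw [h6, map_zero])
    rw [h7, map_zero] at h5
    exact (sub_eq_zero.1 h5.symm)
  have bij : ∀ x, Function.Bijective fun u => e₂.symm u + e₁.symm (x + u) :=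
    fun x => Finite.injective_iff_bijective.1 (inj x)
  have main : ∑ x : Fin n → ZMod 2, ∑ r : Fin n → ZMod 2, f x * g (x + T₁ r) * h (x + T₂ r) =
      ∑ u, ∑ v, f (u + v) * g (u + T₁ (e₂.symm u)) * h (v + T₂ (e₁.symm v)) := by
    have s1 : ∀ x, ∑ r : Fin n → ZMod 2, f x * g (x + T₁ r) * h (x + T₂ r) =
        ∑ u, f x * g (u + T₁ (e₂.symm u)) * h ((x + u) + T₂ (e₁.symm (x + u))) := by
      intro x
      rw [← Equiv.sum_comp (Equiv.ofBijective _ (bij x))]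
      refine Finset.sum_congr rfl fun u _ => ?_
      simp only [Equiv.ofBijective_apply]
      rw [map_add T₁, map_add T₂, h1, h2]
      have e : x + (T₁ (e₂.symm u) + (x + u)) = u + T₁ (e₂.symm u) := by
        linear_combination (exp := 1) two x
      rw [e, add_assoc x u]
    simp only [s1]
    rw [Finset.sum_comm]
    refine Finset.sum_congr rfl fun u _ => ?_
    rw [gvn_shift u]
    refine Finset.sum_congr rfl fun v _ => ?_
    have e : u + v + u = v := by linear_combination (exp := 1) two u
    rw [e]
  have sqle : ∀ t : ℝ, t ∈ Set.Icc (-1 : ℝ) 1 → t ^ 2 ≤ 1 := fun t ht => by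
    nlinarith [ht.1, ht.2]
  have cs := gvn_cs (fun u v => f (u + v)) (fun u => g (u + T₁ (e₂.symm u)))
    (fun v => h (v + T₂ (e₁.symm v))) (fun _ => sqle _ (hg _)) (fun _ => sqle _ (hh _))
  simp only [gvn_box] at cs
  rw [← main] at cs
  have hN : (0 : ℝ) < Fintype.card (Fin n → ZMod 2) := by exact_mod_cast Fintype.card_pos
  set S := ∑ x : Fin n → ZMod 2, ∑ r : Fin n → ZMod 2, f x * g (x + T₁ r) * h (x + T₂ r)
  have fin : |S / ((Fintype.card (Fin n → ZMod 2) : ℝ) * (Fintype.card (Fin n → ZMod 2) : ℝ))| ^ 4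
      ≤ gowersPow n 2 f := by
    rw [gvn_pow, Even.pow_abs (by decide), div_pow, div_le_div_iff₀ (by positivity) (by positivity)]
    generalize (Fintype.card (Fin n → ZMod 2) : ℝ) = N at *
    have := mul_le_mul_of_nonneg_right cs (show 0 ≤ N ^ 3 by positivity)
    refine this.trans (le_of_eq ?_)
    ring
  unfold gowersNorm
  have := Real.rpow_le_rpow (by positivity) fin (show (0 : ℝ) ≤ ((2 : ℝ) ^ 2)⁻¹ by positivity)
  refine le_trans (le_of_eq ?_) this
  rw [← Real.rpow_natCast, ← Real.rpow_mul (abs_nonneg _)]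
  norm_num
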